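/- For every integer m ≥ 3 there exists a unique ℤ-bilinear alternating form δ : A_m × A_m → ℚ such that δ(e_j − e_i, e_k − e_i) = 1/2 for all indices 0 ≤ i < j < k ≤ m−1. Moreover this unique form takes all its values in (1/2)ℤ. -/

import Mathlib

/-- The group `A_m = { x : Fin m → ℤ | Σ_i x i = 0 }`, attached to the star of a
vertex of valency `m` of a ribbon graph. -/
def Amod (m : ℕ) : Submodule ℤ (Fin m → ℤ) where
  carrier := {x | ∑ i, x i = 0}
  add_mem' := by
    intro a b ha hb
    simp only [Set.mem_setOf_eq] at *
    simp [Finset.sum_add_distrib, ha, hb]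
  zero_mem' := by simp
  smul_mem' := by
    intro c x hx
    simp only [Set.mem_setOf_eq, Pi.smul_apply, smul_eq_mul] at *
    simp [← Finset.mul_sum, hx]

lemma mem_Amod (m : ℕ) (x : Fin m → ℤ) : x ∈ Amod m ↔ ∑ i, x i = 0 := Iff.rfl

/-- The element `e_j - e_i` of `A_m`, representing the oriented path through the vertex
entering along the `i`-th edge and leaving along the `j`-th edge. -/
def pathElem (m : ℕ) (i j : Fin m) : Amod m :=
  ⟨Pi.single j (1 : ℤ) - Pi.single i (1 : ℤ), by
    rw [mem_Amod]
    simp [Pi.sub_apply, Finset.sum_sub_distrib, Finset.sum_pi_single']⟩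

/-- The integer-valued sign matrix. -/
def sgnC (m : ℕ) (a b : Fin m) : ℤ := if a < b then 1 else if b < a then -1 else 0

/-- The standard form. -/
noncomputable def stdForm (m : ℕ) : Amod m →ₗ[ℤ] Amod m →ₗ[ℤ] ℚ :=
  LinearMap.mk₂ ℤ
    (fun x y => ∑ a, ∑ b, ((sgnC m a b : ℚ) / 2) * ((x.1 a : ℚ) * (y.1 b : ℚ)))
    (by
      intro x x' y
      simp only [← Finset.sum_add_distrib]
      refine Finset.sum_congr rfl fun a _ => Finset.sum_congr rfl fun b _ => ?_
      simp only [Submodule.coe_add, Pi.add_apply, Int.cast_add]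
      ring)
    (by
      intro c x y
      simp only [Finset.smul_sum]
      refine Finset.sum_congr rfl fun a _ => Finset.sum_congr rfl fun b _ => ?_
      simp only [Submodule.coe_smul, Pi.smul_apply, smul_eq_mul, zsmul_eq_mul, Int.cast_mul]
      ring)
    (by
      intro x y y'
      simp only [← Finset.sum_add_distrib]
      refine Finset.sum_congr rfl fun a _ => Finset.sum_congr rfl fun b _ => ?_
      simp only [Submodule.coe_add, Pi.add_apply, Int.cast_add]
      ring)
    (by
      intro c x y
      simp only [Finset.smul_sum]
      refine Finset.sum_congr rfl fun a _ => Finset.sum_congr rfl fun b _ => ?_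
      simp only [Submodule.coe_smul, Pi.smul_apply, smul_eq_mul, zsmul_eq_mul, Int.cast_mul]
      ring)

lemma stdForm_apply (m : ℕ) (x y : Amod m) : stdForm m x y =
    ∑ a, ∑ b, ((sgnC m a b : ℚ) / 2) * ((x.1 a : ℚ) * (y.1 b : ℚ)) := rfl

lemma sgnC_antisymm (m : ℕ) (a b : Fin m) : sgnC m b a = - sgnC m a b := by
  unfold sgnC
  split_ifs <;> first | rfl | (exfalso; omega)

lemma stdForm_self (m : ℕ) (x : Amod m) : stdForm m x x = 0 := by
  have h : stdForm m x x = - stdForm m x x := by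
    conv_lhs => rw [stdForm_apply, Finset.sum_comm]
    rw [stdForm_apply, ← Finset.sum_neg_distrib]
    refine Finset.sum_congr rfl fun a _ => ?_
    rw [← Finset.sum_neg_distrib]
    refine Finset.sum_congr rfl fun b _ => ?_
    rw [sgnC_antisymm m a b]
    push_cast
    ring
  linarith

lemma sum_path (m : ℕ) (i j : Fin m) (f : Fin m → ℚ) :
    ∑ a, f a * (((pathElem m i j).1 a : ℤ) : ℚ) = f j - f i := by
  simp [pathElem, Pi.single_apply, mul_sub, Finset.sum_sub_distrib]

lemma stdForm_path (m : ℕ) (i j k l : Fin m) :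
    stdForm m (pathElem m i j) (pathElem m k l) =
      ((sgnC m j l : ℚ) - sgnC m j k - sgnC m i l + sgnC m i k) / 2 := by
  rw [stdForm_apply]
  have h : ∀ a : Fin m, ∑ b, ((sgnC m a b : ℚ) / 2) *
      (((pathElem m i j).1 a : ℚ) * ((pathElem m k l).1 b : ℚ)) =
      ((sgnC m a l : ℚ) / 2 - (sgnC m a k : ℚ) / 2) * ((pathElem m i j).1 a : ℚ) := by
    intro a
    rw [← sum_path m k l (fun b => (sgnC m a b : ℚ) / 2), Finset.sum_mul]
    refine Finset.sum_congr rfl fun b _ => ?_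
    ring
  simp only [h]
  rw [sum_path m i j (fun a => (sgnC m a l : ℚ) / 2 - (sgnC m a k : ℚ) / 2)]
  ring

lemma decomp (m : ℕ) (z : Fin m) (x : Amod m) : x = ∑ j, x.1 j • pathElem m z j := by
  apply Subtype.ext
  funext a
  have hx : ∑ i, x.1 i = 0 := x.2
  simp [pathElem, Pi.single_apply, mul_sub, Finset.sum_sub_distrib, ← Finset.sum_mul, hx]

lemma expand (m : ℕ) (z : Fin m) (δ : Amod m →ₗ[ℤ] Amod m →ₗ[ℤ] ℚ) (x y : Amod m) :
    δ x y = ∑ j, ∑ k, (x.1 j : ℚ) * ((y.1 k : ℚ) * δ (pathElem m z j) (pathElem m z k)) := by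
  conv_lhs => rw [decomp m z x, decomp m z y]
  simp only [map_sum, LinearMap.sum_apply, map_zsmul, LinearMap.smul_apply, zsmul_eq_mul,
    Finset.mul_sum]
  first
  | done
  | rfl
  | exact Finset.sum_comm
  | (rw [Finset.sum_comm]
     refine Finset.sum_congr rfl fun a _ => Finset.sum_congr rfl fun b _ => ?_
     ring)

lemma path_self (m : ℕ) (i : Fin m) : pathElem m i i = 0 := by
  apply Subtype.ext
  simp [pathElem]

lemma value (m : ℕ) (z : Fin m) (hz : ∀ j, z ≤ j) (δ : Amod m →ₗ[ℤ] Amod m →ₗ[ℤ] ℚ)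
    (h1 : ∀ x : Amod m, δ x x = 0)
    (h2 : ∀ i j k : Fin m, i < j → j < k → δ (pathElem m i j) (pathElem m i k) = 1 / 2)
    (j k : Fin m) : δ (pathElem m z j) (pathElem m z k) =
      ((if j = z ∨ k = z then 0 else sgnC m j k : ℤ) : ℚ) / 2 := by
  have skew : ∀ x y, δ x y = - δ y x := by
    intro x y
    have h := h1 (x + y)
    simp only [map_add, LinearMap.add_apply, h1] at h
    linarith
  by_cases hj : j = z
  · subst hj; simp [path_self]
  by_cases hk : k = z
  · subst hk; simp [path_self]
  have hj' : z < j := lt_of_le_of_ne (hz j) (Ne.symm hj)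
  have hk' : z < k := lt_of_le_of_ne (hz k) (Ne.symm hk)
  rcases lt_trichotomy j k with h | h | h
  · rw [h2 z j k hj' h]; simp [hj, hk, sgnC, h]
  · subst h; simp [h1, sgnC]
  · rw [skew, h2 z k j hk' h]
    simp [hj, hk, sgnC, h, h.not_gt]
    try norm_num

/-- For `m ≥ 3` there is a unique alternating `ℤ`-bilinear form
`δ : A_m × A_m → ℚ` with `δ(e_j - e_i, e_k - e_i) = 1/2` for all `i < j < k`;
moreover this unique form takes all its values in `(1/2)ℤ`. -/
theorem existsUnique_local_pairing (m : ℕ) (hm : 3 ≤ m) :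
    (∃! δ : Amod m →ₗ[ℤ] Amod m →ₗ[ℤ] ℚ,
      (∀ x : Amod m, δ x x = 0) ∧
      (∀ i j k : Fin m, i < j → j < k →
        δ (pathElem m i j) (pathElem m i k) = 1 / 2)) ∧
    (∀ δ : Amod m →ₗ[ℤ] Amod m →ₗ[ℤ] ℚ,
      ((∀ x : Amod m, δ x x = 0) ∧
       (∀ i j k : Fin m, i < j → j < k →
         δ (pathElem m i j) (pathElem m i k) = 1 / 2)) →
      ∀ x y : Amod m, ∃ n : ℤ, δ x y = (n : ℚ) / 2) := by
  have hz : ∀ j : Fin m, (⟨0, by omega⟩ : Fin m) ≤ j := fun j => Nat.zero_le _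
  refine ⟨⟨stdForm m, ⟨stdForm_self m, ?_⟩, ?_⟩, ?_⟩
  · intro i j k hij hjk
    rw [stdForm_path]
    have hik := hij.trans hjk
    simp [sgnC, hij, hjk, hik, hij.not_gt]
  · rintro δ ⟨h1, h2⟩
    have h3 : ∀ i j k : Fin m, i < j → j < k →
        stdForm m (pathElem m i j) (pathElem m i k) = 1 / 2 := by
      intro i j k hij hjk
      rw [stdForm_path]
      have hik := hij.trans hjk
      simp [sgnC, hij, hjk, hik, hij.not_gt]
    refine LinearMap.ext fun x => LinearMap.ext fun y => ?_
    rw [expand m ⟨0, by omega⟩ δ, expand m ⟨0, by omega⟩ (stdForm m)]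
    simp only [value m _ hz δ h1 h2, value m _ hz (stdForm m) (stdForm_self m) h3]
  · rintro δ ⟨h1, h2⟩ x y
    rw [expand m ⟨0, by omega⟩ δ]
    simp only [value m _ hz δ h1 h2]
    refine ⟨∑ j, ∑ k, x.1 j * (y.1 k *
      (if j = ⟨0, by omega⟩ ∨ k = ⟨0, by omega⟩ then 0 else sgnC m j k)), ?_⟩
    rw [Int.cast_sum, Finset.sum_div]
    refine Finset.sum_congr rfl fun a _ => ?_
    rw [Int.cast_sum, Finset.sum_div]
    refine Finset.sum_congr rfl fun b _ => ?_
    rw [Int.cast_mul, Int.cast_mul]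
    ring
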